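/- Let k and n be positive integers, let p be a prime number with p ≡ 2 (mod 3), and let r be a nonnegative integer such that p divides 3r + 2. Then B_{3,7}( p^{k+1} n + p r + (2p − 1)/3 ) ≡ −(−7/p)_L · B_{3,7}( p^{k−1} n + (3r + 2 − p)/(3p) ) (mod 3). -/

import Mathlib

/-- The number of `t`-regular partitions of `n`, i.e. partitions of `n`
none of whose parts is divisible by `t`. -/
noncomputable def regularPartitionCount (t n : ℕ) : ℕ :=
  Nat.card {π : n.Partition // ∀ x ∈ π.parts, ¬ t ∣ x}

/-- `B u v n` is the number of `(u,v)`-regular bipartitions of `n`: pairs `(α, β)` of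
partitions with `|α| + |β| = n`, `α` being `u`-regular and `β` being `v`-regular. -/
noncomputable def B (u v n : ℕ) : ℕ :=
  ∑ i ∈ Finset.range (n + 1), regularPartitionCount u i * regularPartitionCount v (n - i)

open PowerSeries

theorem regularPartitionCount_eq_card_countRestricted {t : ℕ} (ht : 0 < t) (n : ℕ) :
    regularPartitionCount t n = (Nat.Partition.countRestricted n t).card := by
  rw [← Nat.Partition.card_restricted_eq_card_countRestricted n ht, regularPartitionCount,
    Nat.card_eq_fintype_card, Fintype.card_subtype, Nat.Partition.restricted]

section
open PowerSeries.WithPiTopology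

theorem mk_regularPartitionCount_three :
    (PowerSeries.mk fun n => (regularPartitionCount 3 n : ZMod 3)) =
      pentagonalSeries (ZMod 3) ^ 2 := by
  let : TopologicalSpace (ZMod 3) := ⊥
  have : DiscreteTopology (ZMod 3) := ⟨rfl⟩
  have h := hasProd_one_sub_X_pow (ZMod 3)
  have h' := Nat.Partition.hasProd_powerSeriesMk_card_countRestricted (ZMod 3) (m := 3) (by simp)
  simp_rw [regularPartitionCount_eq_card_countRestricted (t := 3) (by simp)]
  refine h'.unique ?_
  have h3 : (3 : (ZMod 3)⟦X⟧) = 0 := by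
    have : ((3 : ℕ) : (ZMod 3)⟦X⟧) = 0 := by
      rw [← map_natCast (C (R := ZMod 3)), ZMod.natCast_self, map_zero]
    exact_mod_cast this
  have hterm : (fun i => ∑ j ∈ Finset.range 3, X ^ ((i + 1) * j)) =
      fun i => (1 - X ^ (i + 1) : (ZMod 3)⟦X⟧) * (1 - X ^ (i + 1)) := by
    funext i
    simp_rw [pow_mul, Finset.sum_range_succ, Finset.sum_range_zero]
    linear_combination (X ^ (i + 1)) * h3
  rw [hterm, pow_two]
  exact h.mul h

theorem hasProd_expand {R : Type*} [CommRing R] [TopologicalSpace R] (t : ℕ) (ht : t ≠ 0) :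
    HasProd (fun i => (1 - X ^ ((i + 1) * t) : R⟦X⟧)) (expand t ht (pentagonalSeries R)) := by
  have hc : Continuous (expand t ht : R⟦X⟧ →ₐ[R] R⟦X⟧) := by
    rw [continuous_iff_continuousAt]
    intro f
    rw [ContinuousAt, tendsto_iff_coeff_tendsto]
    intro d
    simp_rw [coeff_expand]
    split_ifs
    · exact (continuous_coeff R _).tendsto f
    · exact tendsto_const_nhds
  have h := (hasProd_one_sub_X_pow R).map (expand t ht : R⟦X⟧ →ₐ[R] R⟦X⟧) hc
  convert h using 2 with i
  simp [← pow_mul, mul_comm]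

theorem mk_regularPartitionCount_mul {R : Type*} [CommRing R] {t : ℕ} (ht : t ≠ 0) :
    (PowerSeries.mk fun n => (regularPartitionCount t n : R)) * pentagonalSeries R =
      expand t ht (pentagonalSeries R) := by
  let : TopologicalSpace R := ⊥
  have : DiscreteTopology R := ⟨rfl⟩
  have h := hasProd_one_sub_X_pow R
  have h' := Nat.Partition.hasProd_powerSeriesMk_card_countRestricted R (Nat.pos_of_ne_zero ht)
  simp_rw [regularPartitionCount_eq_card_countRestricted (Nat.pos_of_ne_zero ht)]
  have hterm : (fun i => (∑ j ∈ Finset.range t, X ^ ((i + 1) * j)) * (1 - X ^ (i + 1))) =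
      fun i => (1 - X ^ ((i + 1) * t) : R⟦X⟧) := by
    funext i
    simp_rw [pow_mul, geom_sum_mul_neg]
  refine (h'.mul h).unique ?_
  rw [hterm]
  exact hasProd_expand t ht

end

theorem natCast_B_three_seven (n : ℕ) :
    (B 3 7 n : ZMod 3) =
      (pentagonalSeries (ZMod 3) * expand 7 (by simp) (pentagonalSeries (ZMod 3))).coeff n := by
  rw [← mk_regularPartitionCount_mul, mul_left_comm, mul_comm (PowerSeries.mk _), ← pow_two,
    ← mk_regularPartitionCount_three, coeff_mul, B,
    Finset.Nat.sum_antidiagonal_eq_sum_range_succ_mk]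
  simp

theorem exists_sq_add_seven_mul_sq {p : ℕ} [Fact p.Prime] (h3 : p % 3 = 2) (h2 : p ≠ 2)
    (h : legendreSym p (-7) = 1) : ∃ u v : ℤ, u ^ 2 + 7 * v ^ 2 = p := by
  have hp : p.Prime := Fact.out
  have h70 : ((-7 : ℤ) : ZMod p) ≠ 0 := by
    intro h0
    rw [(legendreSym.eq_zero_iff p (-7)).2 h0] at h
    exact zero_ne_one h
  obtain ⟨c, hc⟩ := (legendreSym.eq_one_iff p h70).1 h
  have hq : p.sqrt ^ 2 < p := by
    rcases (Nat.sqrt_le' p).lt_or_eq with h | h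
    · exact h
    · exact absurd (h ▸ hp) (Nat.Prime.not_prime_pow le_rfl)
  obtain ⟨a, ha, b, hb, hab, he⟩ :=
    Finset.exists_ne_map_eq_of_card_lt_of_maps_to
      (s := Finset.range (p.sqrt + 1) ×ˢ Finset.range (p.sqrt + 1))
      (t := (Finset.univ : Finset (ZMod p)))
      (f := fun a => (a.1 : ZMod p) - c * a.2) (by
        rw [Finset.card_univ, ZMod.card, Finset.card_product, Finset.card_range]
        exact Nat.lt_succ_sqrt p) (fun _ _ => Finset.mem_univ _)
  simp only [Finset.mem_product, Finset.mem_range] at ha hb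
  obtain ⟨s, hs⟩ : ∃ s : ℤ, s = a.1 - b.1 := ⟨_, rfl⟩
  obtain ⟨t, ht⟩ : ∃ t : ℤ, t = a.2 - b.2 := ⟨_, rfl⟩
  have hs2 : s ^ 2 < p := by
    have : s ^ 2 ≤ (p.sqrt : ℤ) ^ 2 := sq_le_sq' (by omega) (by omega)
    exact this.trans_lt (by exact_mod_cast hq)
  have ht2 : t ^ 2 < p := by
    have : t ^ 2 ≤ (p.sqrt : ℤ) ^ 2 := sq_le_sq' (by omega) (by omega)
    exact this.trans_lt (by exact_mod_cast hq)
  have hne : 0 < s ^ 2 + 7 * t ^ 2 := by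
    by_contra hcon
    have hs0 : s = 0 := by nlinarith [sq_nonneg s, sq_nonneg t]
    have ht0 : t = 0 := by nlinarith [sq_nonneg s, sq_nonneg t]
    exact hab (Prod.ext (by omega) (by omega))
  have hdvd : (p : ℤ) ∣ s ^ 2 + 7 * t ^ 2 := by
    rw [← ZMod.intCast_zmod_eq_zero_iff_dvd]
    have hst : (s : ZMod p) = c * t := by
      rw [hs, ht]; push_cast; linear_combination he
    push_cast at hc ⊢
    rw [hst]
    linear_combination (-(t : ZMod p) ^ 2) * hc
  obtain ⟨k, hk⟩ := hdvd
  have hp0 : (0 : ℤ) < p := by exact_mod_cast hp.pos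
  have hk0 : 0 < k := by
    by_contra hcon
    nlinarith
  have hk8 : k < 8 := by
    by_contra hcon
    nlinarith
  have hodd : (p : ℤ) % 2 = 1 := by
    have := hp.eq_two_or_odd
    omega
  have h3' : (p : ℤ) % 3 = 2 := by omega
  have hsq8 : ∀ z : ℤ, z % 2 = 1 → z ^ 2 % 8 = 1 := by
    intro z hz
    have : z % 8 = 1 ∨ z % 8 = 3 ∨ z % 8 = 5 ∨ z % 8 = 7 := by omega
    rcases this with h | h | h | h <;> simp [pow_two, Int.mul_emod, h]
  have hsq2 : ∀ z : ℤ, z ^ 2 % 2 = z % 2 := by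
    intro z
    rcases Int.emod_two_eq_zero_or_one z with h | h <;> simp [pow_two, Int.mul_emod, h]
  have heven : k % 2 = 0 → ∃ s' t', s = 2 * s' ∧ t = 2 * t' := by
    intro hk2
    have h1 : p * k % 2 = 0 := by rw [Int.mul_emod, hk2]; simp
    rcases Int.emod_two_eq_zero_or_one s with hs1 | hs1
    · have := hsq2 s
      have := hsq2 t
      exact ⟨s / 2, t / 2, by omega, by omega⟩
    · exfalso
      have := hsq2 t
      have := hsq8 s hs1
      have := hsq8 t (by omega)
      interval_cases k <;> omega
  have hthree : k = 3 → False := by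
    rintro rfl
    have hz : ∀ z : ℤ, z ^ 2 % 3 = 0 ∧ 3 ∣ z ∨ z ^ 2 % 3 = 1 := by
      intro z
      have : z % 3 = 0 ∨ z % 3 = 1 ∨ z % 3 = 2 := by omega
      rcases this with h | h | h <;> simp [pow_two, Int.mul_emod, h, Int.dvd_iff_emod_eq_zero]
    obtain ⟨⟨-, s', rfl⟩, -, t', rfl⟩ : (s ^ 2 % 3 = 0 ∧ 3 ∣ s) ∧ t ^ 2 % 3 = 0 ∧ 3 ∣ t := by
      have := hz s
      have := hz t
      omega
    ring_nf at hk
    omega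
  have hfive : k = 5 → False := by
    rintro rfl
    have hz : ∀ z : ℤ, z ^ 2 % 5 = 0 ∧ 5 ∣ z ∨ z ^ 2 % 5 = 1 ∨ z ^ 2 % 5 = 4 := by
      intro z
      have : z % 5 = 0 ∨ z % 5 = 1 ∨ z % 5 = 2 ∨ z % 5 = 3 ∨ z % 5 = 4 := by omega
      rcases this with h | h | h | h | h <;>
        simp [pow_two, Int.mul_emod, h, Int.dvd_iff_emod_eq_zero]
    obtain ⟨⟨-, s', rfl⟩, -, t', rfl⟩ : (s ^ 2 % 5 = 0 ∧ 5 ∣ s) ∧ t ^ 2 % 5 = 0 ∧ 5 ∣ t := by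
      have := hz s
      have := hz t
      omega
    ring_nf at hk
    have h5 : 5 ∣ p := by omega
    obtain rfl := (Nat.prime_dvd_prime_iff_eq Nat.prime_five hp).1 h5
    have h57 : @legendreSym 5 ⟨Nat.prime_five⟩ (-7) ≠ 1 := by decide
    exact h57 h
  interval_cases k
  · exact ⟨s, t, by linarith⟩
  · obtain ⟨s', t', rfl, rfl⟩ := heven rfl
    ring_nf at hk
    omega
  · exact (hthree rfl).elim
  · obtain ⟨s', t', rfl, rfl⟩ := heven rfl
    exact ⟨s', t', by linarith⟩
  · exact (hfive rfl).elim
  · obtain ⟨s', t', rfl, rfl⟩ := heven rfl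
    ring_nf at hk
    omega
  · have h7 : (7 : ℤ) ∣ s :=
      Int.Prime.dvd_pow' (by norm_num) (n := s) (k := 2) (by push_cast; omega)
    obtain ⟨s', rfl⟩ := h7
    exact ⟨t, s', by linarith⟩

theorem quadraticChar_three_add_eq_zero (u v x y : ZMod 3) (h : u ^ 2 + 7 * v ^ 2 = 2)
    (h' : x ^ 2 + 7 * y ^ 2 = 1) :
    quadraticChar (ZMod 3) (u * x - 7 * v * y) * quadraticChar (ZMod 3) (u * y + v * x) +
      quadraticChar (ZMod 3) (u * x + 7 * v * y) * quadraticChar (ZMod 3) (u * y - v * x) = 0 := by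
  decide +revert

theorem χ₄_mul_eq (u v x y : ZMod 4) (h : u ^ 2 + 7 * v ^ 2 = 1 ∨ u ^ 2 + 7 * v ^ 2 = 3)
    (h' : x ^ 2 + 7 * y ^ 2 = 0) :
    ZMod.χ₄ (u * x - 7 * v * y) * ZMod.χ₄ (u * y + v * x) =
      ZMod.χ₄ (u * x + 7 * v * y) * ZMod.χ₄ (u * y - v * x) := by
  decide +revert

/-- The even quadratic character of conductor `12`, as a function on the integers. -/
def χ₁₂ (x : ℤ) : ℤ := ZMod.χ₄ x * quadraticChar (ZMod 3) x

theorem χ₁₂_mul (x y : ℤ) : χ₁₂ (x * y) = χ₁₂ x * χ₁₂ y := by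
  simp only [χ₁₂, Int.cast_mul, map_mul]
  ring

theorem χ₁₂_neg (x : ℤ) : χ₁₂ (-x) = χ₁₂ x := by
  have h4 : ∀ a : ZMod 4, ZMod.χ₄ (-a) = - ZMod.χ₄ a := by decide
  have h3 : ∀ a : ZMod 3, quadraticChar (ZMod 3) (-a) = - quadraticChar (ZMod 3) a := by decide
  simp only [χ₁₂, Int.cast_neg, h4, h3, neg_mul_neg]

theorem χ₁₂_sq {x : ℤ} (h2 : ¬ 2 ∣ x) (h3 : ¬ 3 ∣ x) : χ₁₂ x ^ 2 = 1 := by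
  have h4' : (x : ZMod 4) = 1 ∨ (x : ZMod 4) = 3 := by
    have hx : x % 4 = 1 ∨ x % 4 = 3 := by omega
    rw [← ZMod.intCast_mod x 4]
    rcases hx with h | h <;> simp [h]
  have h3' : (x : ZMod 3) = 1 ∨ (x : ZMod 3) = 2 := by
    have hx : x % 3 = 1 ∨ x % 3 = 2 := by omega
    rw [← ZMod.intCast_mod x 3]
    rcases hx with h | h <;> simp [h]
  rcases h4' with h | h <;> rcases h3' with h' | h' <;> rw [χ₁₂, h, h'] <;> decide

theorem χ₁₂_of_two_dvd {x : ℤ} (h : 2 ∣ x) : χ₁₂ x = 0 := by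
  have : (x : ZMod 4) = 0 ∨ (x : ZMod 4) = 2 := by
    have hx : x % 4 = 0 ∨ x % 4 = 2 := by omega
    rw [← ZMod.intCast_mod x 4]
    rcases hx with h | h <;> simp [h]
  have h4 : ZMod.χ₄ x = 0 := by rcases this with h | h <;> rw [h] <;> decide
  rw [χ₁₂, h4, zero_mul]

theorem χ₁₂_of_three_dvd {x : ℤ} (h : 3 ∣ x) : χ₁₂ x = 0 := by
  have : (x : ZMod 3) = 0 := (ZMod.intCast_zmod_eq_zero_iff_dvd x 3).2 h
  rw [χ₁₂, this, MulChar.map_zero, mul_zero]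

/-- The integer points on the ellipse `x ^ 2 + 7 * y ^ 2 = N`. -/
noncomputable def ellipsePoints (N : ℤ) : Finset (ℤ × ℤ) :=
  (Finset.Icc (-N) N ×ˢ Finset.Icc (-N) N).filter fun z => z.1 ^ 2 + 7 * z.2 ^ 2 = N

theorem mem_ellipsePoints {N : ℤ} {z : ℤ × ℤ} :
    z ∈ ellipsePoints N ↔ z.1 ^ 2 + 7 * z.2 ^ 2 = N := by
  simp only [ellipsePoints, Finset.mem_filter, Finset.mem_product, Finset.mem_Icc,
    and_iff_right_iff_imp]
  intro h
  have h1 : |z.1| ≤ z.1 ^ 2 := by rw [← Int.natCast_natAbs]; exact Int.natAbs_le_self_sq z.1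
  have h2 : |z.2| ≤ z.2 ^ 2 := by rw [← Int.natCast_natAbs]; exact Int.natAbs_le_self_sq z.2
  have := neg_abs_le z.1
  have := neg_abs_le z.2
  have := le_abs_self z.1
  have := le_abs_self z.2
  have := sq_nonneg z.1
  have := sq_nonneg z.2
  refine ⟨⟨?_, ?_⟩, ?_, ?_⟩ <;> omega

/-- The product of the character values of the two coordinates. -/
def weight (z : ℤ × ℤ) : ℤ := χ₁₂ z.1 * χ₁₂ z.2

/-- The coefficients of the theta series attached to `x ^ 2 + 7 * y ^ 2` weighted by `χ₁₂`. -/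
noncomputable def thetaCoeff (N : ℤ) : ℤ := ∑ z ∈ ellipsePoints N, weight z

theorem weight_smul {p : ℤ} (h2 : ¬ 2 ∣ p) (h3 : ¬ 3 ∣ p) (z : ℤ × ℤ) :
    weight (p * z.1, p * z.2) = weight z := by
  simp only [weight, χ₁₂_mul]
  linear_combination (χ₁₂ z.1 * χ₁₂ z.2) * χ₁₂_sq h2 h3

theorem sum_filter_dvd_ellipsePoints {p : ℤ} (h2 : ¬ 2 ∣ p) (h3 : ¬ 3 ∣ p) (K : ℤ) :
    ∑ z ∈ ellipsePoints (p ^ 2 * K) with p ∣ z.1 ∧ p ∣ z.2, weight z = thetaCoeff K := by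
  have hp0 : p ≠ 0 := by rintro rfl; simp at h2
  symm
  refine Finset.sum_bij (fun z _ => (p * z.1, p * z.2)) ?_ ?_ ?_ ?_
  · intro z hz
    rw [mem_ellipsePoints] at hz
    simp only [Finset.mem_filter, mem_ellipsePoints, dvd_mul_right, and_self, and_true]
    linear_combination p ^ 2 * hz
  · intro z _ w _ h
    simp only [Prod.mk.injEq, mul_right_inj' hp0] at h
    exact Prod.ext h.1 h.2
  · rintro ⟨x, y⟩ hz
    simp only [Finset.mem_filter, mem_ellipsePoints] at hz
    obtain ⟨hz, ⟨x', rfl⟩, ⟨y', rfl⟩⟩ := hz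
    refine ⟨(x', y'), ?_, rfl⟩
    rw [mem_ellipsePoints]
    refine mul_left_cancel₀ (pow_ne_zero 2 hp0) ?_
    linear_combination hz
  · intro z _
    exact (weight_smul h2 h3 z).symm

theorem thetaCoeff_mul_sq_of_inert {p : ℕ} [Fact p.Prime] (h2 : p ≠ 2) (h3 : p ≠ 3)
    (h : legendreSym p (-7) = -1) (K : ℤ) : thetaCoeff (p ^ 2 * K) = thetaCoeff K := by
  have hp : p.Prime := Fact.out
  have h2' : ¬ (2 : ℤ) ∣ p := by
    exact_mod_cast fun h => h2 ((Nat.prime_dvd_prime_iff_eq Nat.prime_two hp).1 h).symm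
  have h3' : ¬ (3 : ℤ) ∣ p := by
    exact_mod_cast fun h => h3 ((Nat.prime_dvd_prime_iff_eq Nat.prime_three hp).1 h).symm
  rw [← sum_filter_dvd_ellipsePoints h2' h3' K, Finset.filter_true_of_mem, thetaCoeff]
  intro z hz
  rw [mem_ellipsePoints] at hz
  have h0 : (z.1 : ZMod p) ^ 2 - (-7 : ℤ) * (z.2 : ZMod p) ^ 2 = 0 := by
    have := congrArg (Int.cast : ℤ → ZMod p) hz
    push_cast at this ⊢
    rw [ZMod.natCast_self] at this
    linear_combination this
  simp_rw [← ZMod.intCast_zmod_eq_zero_iff_dvd]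
  exact legendreSym.eq_zero_mod_of_eq_neg_one h h0

theorem weight_add_weight_eq_zero {u v x y : ℤ} (h3 : (u ^ 2 + 7 * v ^ 2) % 3 = 2)
    (h2 : (u ^ 2 + 7 * v ^ 2) % 2 = 1) (hxy3 : (x ^ 2 + 7 * y ^ 2) % 3 = 1)
    (hxy4 : (x ^ 2 + 7 * y ^ 2) % 4 = 0) :
    weight (u * x - 7 * v * y, u * y + v * x) + weight (u * x + 7 * v * y, u * y - v * x) = 0 := by
  have e3 : ((u ^ 2 + 7 * v ^ 2 : ℤ) : ZMod 3) = 2 := by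
    rw [← ZMod.intCast_mod _ 3]; push_cast [h3]; rfl
  have e3' : ((x ^ 2 + 7 * y ^ 2 : ℤ) : ZMod 3) = 1 := by
    rw [← ZMod.intCast_mod _ 3]; push_cast [hxy3]; rfl
  have e4' : ((x ^ 2 + 7 * y ^ 2 : ℤ) : ZMod 4) = 0 := by
    rw [← ZMod.intCast_mod _ 4]; push_cast [hxy4]; rfl
  have e4 : ((u ^ 2 + 7 * v ^ 2 : ℤ) : ZMod 4) = 1 ∨ ((u ^ 2 + 7 * v ^ 2 : ℤ) : ZMod 4) = 3 := by
    have : (u ^ 2 + 7 * v ^ 2) % 4 = 1 ∨ (u ^ 2 + 7 * v ^ 2) % 4 = 3 := by omega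
    rw [← ZMod.intCast_mod _ 4]
    rcases this with h | h <;> simp [h]
  push_cast at e3 e3' e4 e4'
  have i3 := quadraticChar_three_add_eq_zero _ _ _ _ e3 e3'
  have i4 := χ₄_mul_eq _ _ _ _ e4 e4'
  simp only [weight, χ₁₂]
  push_cast
  linear_combination (ZMod.χ₄ (u * x - 7 * v * y) * ZMod.χ₄ (u * y + v * x)) * i3 -
    (quadraticChar (ZMod 3) (u * x + 7 * v * y) * quadraticChar (ZMod 3) (u * y - v * x)) * i4

theorem sum_filter_dvd_sub {p u v : ℤ} (hp : Prime p) (huv : u ^ 2 + 7 * v ^ 2 = p) (L : ℤ)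
    (f : ℤ × ℤ → ℤ) :
    ∑ z ∈ ellipsePoints (p * L) with p ∣ u * z.2 - v * z.1, f z =
      ∑ z ∈ ellipsePoints L, f (u * z.1 - 7 * v * z.2, u * z.2 + v * z.1) := by
  have hp0 : p ≠ 0 := hp.ne_zero
  symm
  refine Finset.sum_bij (fun z _ => (u * z.1 - 7 * v * z.2, u * z.2 + v * z.1)) ?_ ?_ ?_ ?_
  · intro z hz
    rw [mem_ellipsePoints] at hz
    simp only [Finset.mem_filter, mem_ellipsePoints]
    refine ⟨?_, z.2, ?_⟩
    · rw [← huv, ← hz]; ring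
    · rw [← huv]; ring
  · intro z _ w _ h
    simp only [Prod.mk.injEq] at h
    refine Prod.ext (mul_left_cancel₀ hp0 ?_) (mul_left_cancel₀ hp0 ?_)
    · rw [← huv]; linear_combination u * h.1 + 7 * v * h.2
    · rw [← huv]; linear_combination u * h.2 - v * h.1
  · rintro ⟨a, b⟩ hz
    simp only [Finset.mem_filter, mem_ellipsePoints] at hz
    obtain ⟨hz, ⟨y, hy⟩⟩ := hz
    have hdvd : p ∣ u * a + 7 * v * b := by
      refine hp.dvd_of_dvd_pow (n := 2) ⟨p * L - 7 * p * y ^ 2, ?_⟩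
      linear_combination (a ^ 2 + 7 * b ^ 2) * huv + p * hz - 7 * (u * b - v * a + p * y) * hy
    obtain ⟨x, hx⟩ := hdvd
    refine ⟨(x, y), ?_, ?_⟩
    · rw [mem_ellipsePoints]
      refine mul_left_cancel₀ (pow_ne_zero 2 hp0) ?_
      linear_combination (a ^ 2 + 7 * b ^ 2) * huv + p * hz - 7 * (u * b - v * a + p * y) * hy
        - (u * a + 7 * v * b + p * x) * hx
    · refine Prod.ext (mul_left_cancel₀ hp0 ?_) (mul_left_cancel₀ hp0 ?_)
      · linear_combination a * huv - u * hx + 7 * v * hy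
      · linear_combination b * huv - u * hy - v * hx
  · intro z _
    rfl

theorem not_dvd_two_mul_of_sq_add_seven_mul_sq {p u v : ℤ} (hp : Prime p) (h3 : p % 3 = 2)
    (h2 : p % 2 = 1) (huv : u ^ 2 + 7 * v ^ 2 = p) : ¬ p ∣ 2 * u := by
  have hpos : 0 ≤ p := by rw [← huv]; positivity
  have hnat := Int.prime_iff_natAbs_prime.1 hp
  intro h
  rcases hp.dvd_or_dvd h with h | ⟨c, hc⟩
  · have := (Nat.prime_dvd_prime_iff_eq hnat Nat.prime_two).1 (Int.natAbs_dvd_natAbs.2 h)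
    omega
  have h7 : p ∣ 7 * v ^ 2 := ⟨1 - p * c ^ 2, by linear_combination huv - (u + p * c) * hc⟩
  rcases hp.dvd_or_dvd h7 with h | h
  · have := (Nat.prime_dvd_prime_iff_eq hnat (by norm_num : Nat.Prime 7)).1
      (Int.natAbs_dvd_natAbs.2 h)
    omega
  · obtain ⟨d, rfl⟩ := hp.dvd_of_dvd_pow h
    subst hc
    refine hp.not_isUnit (IsUnit.of_mul_eq_one (c ^ 2 + 7 * d ^ 2) ?_)
    refine mul_left_cancel₀ hp.ne_zero ?_
    linear_combination huv

theorem thetaCoeff_mul_sq_of_split {p u v : ℤ} (hp : Prime p) (h3 : p % 3 = 2) (h2 : p % 2 = 1)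
    (huv : u ^ 2 + 7 * v ^ 2 = p) {K : ℤ} (hK3 : K % 3 = 2) (hK4 : K % 4 = 0) :
    thetaCoeff (p ^ 2 * K) = - thetaCoeff K := by
  have hA := sum_filter_dvd_sub hp huv (p * K) weight
  have hA' := sum_filter_dvd_sub (u := u) (v := -v) hp (by linear_combination huv) (p * K) weight
  have hunion : (ellipsePoints (p * (p * K))).filter (fun z => p ∣ u * z.2 - v * z.1) ∪
      (ellipsePoints (p * (p * K))).filter (fun z => p ∣ u * z.2 - -v * z.1) =
      ellipsePoints (p * (p * K)) := by
    rw [← Finset.filter_or, Finset.filter_true_of_mem]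
    intro z hz
    rw [mem_ellipsePoints] at hz
    refine hp.dvd_or_dvd ⟨z.2 ^ 2 - v ^ 2 * (p * K), ?_⟩
    linear_combination z.2 ^ 2 * huv - v ^ 2 * hz
  have hinter : (ellipsePoints (p * (p * K))).filter (fun z => p ∣ u * z.2 - v * z.1) ∩
      (ellipsePoints (p * (p * K))).filter (fun z => p ∣ u * z.2 - -v * z.1) =
      (ellipsePoints (p ^ 2 * K)).filter (fun z => p ∣ z.1 ∧ p ∣ z.2) := by
    rw [← Finset.filter_and, ← mul_assoc, ← pow_two]
    refine Finset.filter_congr fun z hz => ⟨?_, ?_⟩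
    · rintro ⟨h, h'⟩
      rw [mem_ellipsePoints] at hz
      have hb : p ∣ z.2 := by
        refine (hp.dvd_or_dvd (a := 2 * u) ?_).resolve_left
          (not_dvd_two_mul_of_sq_add_seven_mul_sq hp h3 h2 huv)
        convert dvd_add h h' using 1
        ring
      refine ⟨hp.dvd_of_dvd_pow (n := 2) ?_, hb⟩
      have : z.1 ^ 2 = p * (p * K) - 7 * z.2 * z.2 := by linear_combination hz
      rw [this]
      exact dvd_sub (dvd_mul_right _ _) (hb.mul_left _)
    · rintro ⟨h, h'⟩
      exact ⟨dvd_sub (h'.mul_left _) (h.mul_left _), dvd_sub (h'.mul_left _) (h.mul_left _)⟩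
  have hsum := Finset.sum_union_inter (f := weight)
    (s₁ := (ellipsePoints (p * (p * K))).filter (fun z => p ∣ u * z.2 - v * z.1))
    (s₂ := (ellipsePoints (p * (p * K))).filter (fun z => p ∣ u * z.2 - -v * z.1))
  rw [hunion, hinter, hA, hA', sum_filter_dvd_ellipsePoints (by omega) (by omega),
    ← Finset.sum_add_distrib] at hsum
  rw [pow_two, mul_assoc, thetaCoeff, eq_neg_iff_add_eq_zero, hsum]
  refine Finset.sum_eq_zero fun z hz => ?_
  rw [mem_ellipsePoints] at hz
  have hw := weight_add_weight_eq_zero (x := z.1) (y := z.2) (huv ▸ h3) (huv ▸ h2)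
    (by rw [hz, Int.mul_emod, h3, hK3]; rfl) (by rw [hz, Int.mul_emod, hK4]; simp)
  rw [← hw]
  ring_nf

theorem thetaCoeff_eq_two_mul_sum {N : ℤ} (hN : N % 4 = 0) :
    thetaCoeff N = 2 * ∑ z ∈ ellipsePoints N with z.2 % 2 = 1 ∧ (z.1 - z.2) % 4 = 0, weight z := by
  have h1 : thetaCoeff N = ∑ z ∈ ellipsePoints N with z.2 % 2 = 1, weight z := by
    rw [thetaCoeff, Finset.sum_filter_of_ne]
    intro z _ hz
    by_contra hcon
    exact hz (by rw [weight, χ₁₂_of_two_dvd (x := z.2) (by omega), mul_zero])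
  have hpar : ∀ z ∈ ellipsePoints N, z.2 % 2 = 1 →
      (¬ (z.1 - z.2) % 4 = 0 ↔ (z.1 + z.2) % 4 = 0) := by
    intro z hz hz2
    rw [mem_ellipsePoints] at hz
    have h1 : z.1 % 2 = 1 := by
      by_contra hcon
      obtain ⟨x, hx⟩ : (2 : ℤ) ∣ z.1 := by omega
      obtain ⟨y, hy⟩ : ∃ y, z.2 = 2 * y + 1 := ⟨z.2 / 2, by omega⟩
      rw [hx, hy] at hz
      ring_nf at hz
      omega
    omega
  have h2 : ∑ z ∈ ellipsePoints N with z.2 % 2 = 1 ∧ ¬ (z.1 - z.2) % 4 = 0, weight z =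
      ∑ z ∈ ellipsePoints N with z.2 % 2 = 1 ∧ (z.1 - z.2) % 4 = 0, weight z := by
    refine Finset.sum_nbij' (fun z => (z.1, -z.2)) (fun z => (z.1, -z.2)) ?_ ?_ ?_ ?_ ?_
    · intro z hz
      simp only [Finset.mem_filter] at hz ⊢
      have := (hpar z hz.1 hz.2.1).1 hz.2.2
      rw [mem_ellipsePoints] at hz ⊢
      simp only [even_two, Even.neg_pow]
      exact ⟨hz.1, by omega, by omega⟩
    · intro z hz
      simp only [Finset.mem_filter] at hz ⊢
      have := (hpar z hz.1 hz.2.1)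
      rw [mem_ellipsePoints] at hz ⊢
      simp only [even_two, Even.neg_pow]
      exact ⟨hz.1, by omega, by omega⟩
    · simp
    · simp
    · intro z _
      simp [weight, χ₁₂_neg]
  rw [h1, ← Finset.sum_filter_add_sum_filter_not _ (fun z => (z.1 - z.2) % 4 = 0)]
  rw [Finset.filter_filter, Finset.filter_filter, h2]
  ring

theorem weight_neg_of_odd {y t : ℤ} (hy : y % 2 = 1) (ht : t % 2 = 1) :
    weight (-8 * y - 3 * t, t) = - weight (3 * y + 2 * t, y) := by
  have h4 : ∀ t y : ZMod 4, (t = 1 ∨ t = 3) → (y = 1 ∨ y = 3) →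
    ZMod.χ₄ (-8 * y - 3 * t) * ZMod.χ₄ t = ZMod.χ₄ (3 * y + 2 * t) * ZMod.χ₄ y := by decide
  have h3 : ∀ t y : ZMod 3,
    quadraticChar (ZMod 3) (-8 * y - 3 * t) * quadraticChar (ZMod 3) t =
      - (quadraticChar (ZMod 3) (3 * y + 2 * t) * quadraticChar (ZMod 3) y) := by decide
  have hodd : ∀ z : ℤ, z % 2 = 1 → (z : ZMod 4) = 1 ∨ (z : ZMod 4) = 3 := by
    intro z hz
    have : z % 4 = 1 ∨ z % 4 = 3 := by omega
    rw [← ZMod.intCast_mod _ 4]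
    rcases this with h | h <;> simp [h]
  have i4 := h4 t y (hodd t ht) (hodd y hy)
  have i3 := h3 t y
  simp only [weight, χ₁₂]
  push_cast
  linear_combination (quadraticChar (ZMod 3) (-8 * y - 3 * t) * quadraticChar (ZMod 3) t) * i4 +
    (ZMod.χ₄ (3 * y + 2 * t) * ZMod.χ₄ y) * i3

theorem thetaCoeff_four_mul {K : ℤ} (hK : K % 8 = 0) : thetaCoeff (4 * K) = - thetaCoeff K := by
  rw [thetaCoeff_eq_two_mul_sum (N := 4 * K) (by omega), thetaCoeff_eq_two_mul_sum (N := K) (by omega),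
    ← mul_neg, ← Finset.sum_neg_distrib]
  congr 1
  symm
  have hodd : ∀ z : ℤ × ℤ, z.2 % 2 = 1 ∧ (z.1 - z.2) % 4 = 0 →
      ∃ t, z.1 = 3 * z.2 + 2 * t ∧ (z.1 - 3 * z.2) / 2 = t ∧ t % 2 = 1 := fun z hz =>
    ⟨(z.1 - 3 * z.2) / 2, by omega, rfl, by omega⟩
  refine Finset.sum_bij
    (fun z _ => (-8 * z.2 - 3 * ((z.1 - 3 * z.2) / 2), (z.1 - 3 * z.2) / 2)) ?_ ?_ ?_ ?_
  · intro z hz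
    rw [Finset.mem_filter, mem_ellipsePoints] at hz
    obtain ⟨t, ht, ht', ht2⟩ := hodd z hz.2
    simp only [Finset.mem_filter, mem_ellipsePoints, ht']
    refine ⟨?_, ht2, by omega⟩
    rw [← hz.1, ht]
    ring
  · intro z hz w hw h
    obtain ⟨t, ht, ht', ht2⟩ := hodd z (Finset.mem_filter.1 hz).2
    obtain ⟨s, hs, hs', hs2⟩ := hodd w (Finset.mem_filter.1 hw).2
    simp only [ht', hs', Prod.mk.injEq] at h
    exact Prod.ext (by omega) (by omega)
  · rintro ⟨a, b⟩ hz
    simp only [Finset.mem_filter, mem_ellipsePoints] at hz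
    obtain ⟨hz, hb, hab⟩ := hz
    obtain ⟨c, hc⟩ : ∃ c, a = b + 4 * c := ⟨(a - b) / 4, by omega⟩
    have hbc : (b + c) % 4 = 2 := by
      have hmul : b * (b + c) + 2 * (c * c) = 4 * (K / 8) := by
        have : K = 8 * (K / 8) := by omega
        rw [hc] at hz
        linarith
      have hc2 : c % 4 = 0 ∨ c % 4 = 1 ∨ c % 4 = 2 ∨ c % 4 = 3 := by omega
      have hb2 : b % 4 = 1 ∨ b % 4 = 3 := by omega
      have hmod := congrArg (· % 4) hmul
      rcases hc2 with h | h | h | h <;> rcases hb2 with h' | h' <;>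
        simp [Int.add_emod, Int.mul_emod, h, h'] at hmod ⊢
    obtain ⟨y, hy⟩ : ∃ y, a = -8 * y - 3 * b := ⟨(-a - 3 * b) / 8, by omega⟩
    have hy2 : y % 2 = 1 := by omega
    refine ⟨(3 * y + 2 * b, y), ?_, ?_⟩
    · simp only [Finset.mem_filter, mem_ellipsePoints]
      refine ⟨?_, hy2, by omega⟩
      subst hy
      linarith
    · have : (3 * y + 2 * b - 3 * y) / 2 = b := by omega
      simp only [this, hy]
  · intro z hz
    obtain ⟨t, ht, ht', ht2⟩ := hodd z (Finset.mem_filter.1 hz).2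
    rw [ht', weight_neg_of_odd (Finset.mem_filter.1 hz).2.1 ht2, ← ht]

theorem sq_emod_of_χ₁₂_ne_zero {x : ℤ} (h : χ₁₂ x ≠ 0) : x ^ 2 % 24 = 1 := by
  have h2 : ¬ 2 ∣ x := fun h2 => h (χ₁₂_of_two_dvd h2)
  have h3 : ¬ 3 ∣ x := fun h3 => h (χ₁₂_of_three_dvd h3)
  have : x % 24 = 1 ∨ x % 24 = 5 ∨ x % 24 = 7 ∨ x % 24 = 11 ∨ x % 24 = 13 ∨ x % 24 = 17 ∨
    x % 24 = 19 ∨ x % 24 = 23 := by omega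
  rcases this with h | h | h | h | h | h | h | h <;> simp [pow_two, Int.mul_emod, h]

theorem χ₁₂_six_mul_sub_one (k : ℤ) : χ₁₂ (6 * k - 1) = k.negOnePow := by
  rcases Int.even_or_odd' k with ⟨m, rfl | rfl⟩
  · have h4 : ((6 * (2 * m) - 1 : ℤ) : ZMod 4) = 3 := by
      rw [← ZMod.intCast_mod _ 4, show (6 * (2 * m) - 1) % ((4 : ℕ) : ℤ) = 3 by omega]; rfl
    have h3 : ((6 * (2 * m) - 1 : ℤ) : ZMod 3) = 2 := by
      rw [← ZMod.intCast_mod _ 3, show (6 * (2 * m) - 1) % ((3 : ℕ) : ℤ) = 2 by omega]; rfl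
    rw [χ₁₂, h4, h3, Int.negOnePow_two_mul]
    decide
  · have h4 : ((6 * (2 * m + 1) - 1 : ℤ) : ZMod 4) = 1 := by
      rw [← ZMod.intCast_mod _ 4, show (6 * (2 * m + 1) - 1) % ((4 : ℕ) : ℤ) = 1 by omega]; rfl
    have h3 : ((6 * (2 * m + 1) - 1 : ℤ) : ZMod 3) = 2 := by
      rw [← ZMod.intCast_mod _ 3, show (6 * (2 * m + 1) - 1) % ((3 : ℕ) : ℤ) = 2 by omega]; rfl
    rw [χ₁₂, h4, h3, Int.negOnePow_two_mul_add_one]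
    decide

/-- The integer square roots of `N`. -/
noncomputable def squareRoots (N : ℤ) : Finset ℤ := (Finset.Icc (-N) N).filter fun x => x ^ 2 = N

theorem mem_squareRoots {N x : ℤ} : x ∈ squareRoots N ↔ x ^ 2 = N := by
  simp only [squareRoots, Finset.mem_filter, Finset.mem_Icc, and_iff_right_iff_imp]
  rintro rfl
  rw [← abs_le, ← Int.natCast_natAbs]
  exact Int.natAbs_le_self_sq x

theorem sum_χ₁₂_squareRoots {R : Type*} [CommRing R] (n : ℕ) :
    ((∑ x ∈ squareRoots (24 * n + 1), χ₁₂ x : ℤ) : R) = 2 * (pentagonalSeries R).coeff n := by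
  by_cases hn : n ∈ Set.range pentagonal
  · obtain ⟨k, rfl⟩ := hn
    have hk := two_mul_natCast_pentagonal k
    have hs : squareRoots (24 * pentagonal k + 1) = {6 * k - 1, -(6 * k - 1)} := by
      ext x
      rw [mem_squareRoots, Finset.mem_insert, Finset.mem_singleton, ← sq_eq_sq_iff_eq_or_eq_neg]
      rw [show (24 * pentagonal k + 1 : ℤ) = (6 * k - 1) ^ 2 by linear_combination 12 * hk]
    rw [hs, Finset.sum_pair (by omega), χ₁₂_neg, χ₁₂_six_mul_sub_one,
      coeff_pentagonalSeries_pentagonal]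
    push_cast
    ring
  · rw [coeff_pentagonalSeries_eq_zero R hn, mul_zero, Finset.sum_eq_zero, Int.cast_zero]
    intro x hx
    rw [mem_squareRoots] at hx
    by_contra h
    have h2 : ¬ 2 ∣ x := fun h2 => h (χ₁₂_of_two_dvd h2)
    have h3 : ¬ 3 ∣ x := fun h3 => h (χ₁₂_of_three_dvd h3)
    have : ∃ k, x ^ 2 = (6 * k - 1) ^ 2 := by
      have : x % 6 = 5 ∨ x % 6 = 1 := by omega
      rcases this with h | h
      · exact ⟨(x + 1) / 6, by congr 1; omega⟩
      · exact ⟨(1 - x) / 6, by rw [← neg_sq x]; congr 1; omega⟩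
    obtain ⟨k, hk⟩ := this
    have hk' := two_mul_natCast_pentagonal k
    refine hn ⟨k, ?_⟩
    have : 24 * (pentagonal k : ℤ) = 24 * n := by linear_combination 12 * hk' - hk + hx
    omega

theorem thetaCoeff_eq_sum (n : ℕ) :
    thetaCoeff (24 * n + 8) = ∑ a ∈ Finset.HasAntidiagonal.antidiagonal n with 7 ∣ a.2,
      (∑ x ∈ squareRoots (24 * a.1 + 1), χ₁₂ x) *
        ∑ y ∈ squareRoots (24 * (a.2 / 7 : ℕ) + 1), χ₁₂ y := by
  have hsupp : thetaCoeff (24 * n + 8) = ∑ z ∈ ellipsePoints (24 * n + 8) with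
      z.1 ^ 2 % 24 = 1 ∧ z.2 ^ 2 % 24 = 1, weight z := by
    rw [thetaCoeff, Finset.sum_filter_of_ne]
    intro z _ hz
    exact ⟨sq_emod_of_χ₁₂_ne_zero (left_ne_zero_of_mul hz),
      sq_emod_of_χ₁₂_ne_zero (right_ne_zero_of_mul hz)⟩
  rw [hsupp, ← Finset.sum_fiberwise_of_maps_to
    (g := fun z : ℤ × ℤ => ((z.1 ^ 2 / 24).toNat, 7 * (z.2 ^ 2 / 24).toNat))
    (t := (Finset.HasAntidiagonal.antidiagonal n).filter fun a => 7 ∣ a.2)]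
  · refine Finset.sum_congr rfl fun a ha => ?_
    simp only [Finset.mem_filter, Finset.HasAntidiagonal.mem_antidiagonal] at ha
    rw [Finset.sum_mul_sum, ← Finset.sum_product']
    refine Finset.sum_congr ?_ fun _ _ => rfl
    ext z
    have := sq_nonneg z.1
    have := sq_nonneg z.2
    simp only [Finset.mem_filter, Finset.mem_product, mem_squareRoots, mem_ellipsePoints,
      Prod.ext_iff]
    omega
  · intro z hz
    have := sq_nonneg z.1
    have := sq_nonneg z.2
    simp only [Finset.mem_filter, mem_ellipsePoints] at hz
    simp only [Finset.mem_filter, Finset.HasAntidiagonal.mem_antidiagonal, dvd_mul_right, and_true]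
    omega

theorem intCast_thetaCoeff (n : ℕ) : (thetaCoeff (24 * n + 8) : ZMod 3) = B 3 7 n := by
  have h4 : (2 * 2 : ZMod 3) = 1 := by decide
  rw [natCast_B_three_seven, thetaCoeff_eq_sum, coeff_mul, Int.cast_sum, Finset.sum_filter]
  refine Finset.sum_congr rfl fun a _ => ?_
  rw [coeff_expand]
  split_ifs with h
  · rw [Int.cast_mul, sum_χ₁₂_squareRoots, sum_χ₁₂_squareRoots]
    linear_combination ((pentagonalSeries (ZMod 3)).coeff a.1 *
      (pentagonalSeries (ZMod 3)).coeff (a.2 / 7)) * h4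
  · rw [mul_zero]

theorem thetaCoeff_mul_sq {p : ℕ} [Fact p.Prime] (hp : p % 3 = 2) {K : ℤ} (hK3 : K % 3 = 2)
    (hK8 : K % 8 = 0) : thetaCoeff (p ^ 2 * K) = -legendreSym p (-7) * thetaCoeff K := by
  have hprime : p.Prime := Fact.out
  rcases eq_or_ne p 2 with rfl | h2
  · have h1 : @legendreSym 2 ⟨Nat.prime_two⟩ (-7) = 1 := by decide
    rw [h1, neg_one_mul, ← thetaCoeff_four_mul hK8]
    norm_num
  have h70 : ((-7 : ℤ) : ZMod p) ≠ 0 := by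
    rw [Ne, ZMod.intCast_zmod_eq_zero_iff_dvd, dvd_neg]
    intro h
    have h7 : p ∣ 7 := by exact_mod_cast h
    have := (Nat.prime_dvd_prime_iff_eq hprime (by norm_num)).1 h7
    omega
  rcases legendreSym.eq_one_or_neg_one p h70 with h | h
  · obtain ⟨u, v, huv⟩ := exists_sq_add_seven_mul_sq hp h2 h
    have := hprime.eq_two_or_odd
    rw [h, neg_one_mul, thetaCoeff_mul_sq_of_split (Nat.prime_iff_prime_int.1 hprime) (by omega)
      (by omega) huv hK3 (by omega)]
  · rw [h, neg_neg, one_mul, thetaCoeff_mul_sq_of_inert h2 (by omega) h]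

/-- Theorem 1.5(i): a multiplicative formula for `B 3 7` modulo 3. -/
theorem B_3_7_mult (k n : ℕ) (hk : 0 < k) (hn : 0 < n) (p : ℕ) (hp : p.Prime)
    (hp2 : p % 3 = 2) (r : ℕ) (hr : p ∣ 3 * r + 2) :
    (B 3 7 (p ^ (k + 1) * n + p * r + (2 * p - 1) / 3) : ℤ)
      ≡ -(@legendreSym p ⟨hp⟩ (-7))
          * (B 3 7 (p ^ (k - 1) * n + (3 * r + 2 - p) / (3 * p)) : ℤ) [ZMOD 3] := by
  have : Fact p.Prime := ⟨hp⟩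
  obtain ⟨k, rfl⟩ : ∃ j, k = j + 1 := ⟨k - 1, by omega⟩
  obtain ⟨c, hc⟩ := hr
  have hc3 : c % 3 = 1 := by
    have : (3 * r + 2) % 3 = 2 * (c % 3) % 3 := by rw [hc, Nat.mul_mod, hp2]
    omega
  obtain ⟨d, rfl⟩ : ∃ d, c = 3 * d + 1 := ⟨c / 3, by omega⟩
  have hd : (3 * r + 2 - p) / (3 * p) = d := by
    rw [hc, show p * (3 * d + 1) - p = 3 * p * d by rw [Nat.sub_eq_iff_eq_add] <;> nlinarith]
    exact Nat.mul_div_cancel_left _ (by have := hp.pos; omega)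
  obtain ⟨q, hq⟩ : ∃ q, p = 3 * q + 2 := ⟨p / 3, by omega⟩
  have hq' : (2 * p - 1) / 3 = 2 * q + 1 := by omega
  rw [hd, hq', Nat.add_sub_cancel]
  refine (ZMod.intCast_eq_intCast_iff _ _ 3).1 ?_
  push_cast
  rw [← intCast_thetaCoeff, ← intCast_thetaCoeff, ← Int.cast_neg, ← Int.cast_mul,
    ← thetaCoeff_mul_sq hp2 (by omega) (by omega)]
  congr 2
  push_cast
  have hc' : (3 * r + 2 : ℤ) = p * (3 * d + 1) := by exact_mod_cast hc
  have hq'' : (p : ℤ) = 3 * q + 2 := by exact_mod_cast hq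
  linear_combination (8 * p : ℤ) * hc' - 16 * hq''
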